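/- Let Ψ satisfy (Ψ1)–(Ψ3) and for M > 0 set h_M := inf_{R_M} H_r. Then for all masses 0 < M̄ ≤ M the scaling inequality h_{M̄} ≥ (M̄/M)^{5/3} h_M holds. -/

import Mathlib

open MeasureTheory Filter Topology Set ENNReal

noncomputable section

/-- Physical space `ℝ³`. -/
abbrev R3 : Type := EuclideanSpace ℝ (Fin 3)

/-- Spatial density `ρ_f(x) = ∫ f(x,v) dv` induced by a phase-space density. -/
def spatialDensity (f : R3 × R3 → ℝ) (x : R3) : ℝ := ∫ v, f (x, v)

/-- Kinetic energy `E_kin(f) = (1/2)∫∫ |v|² f dv dx`. -/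
def Ekin (f : R3 × R3 → ℝ) : ℝ := (1/2) * ∫ p : R3 × R3, ‖p.2‖ ^ 2 * f p

/-- `D(σ) = ∫∫ σ(x)σ(y)/|x-y| dx dy`. -/
def Dpair (σ : R3 → ℝ) : ℝ := ∫ x, ∫ y, σ x * σ y / ‖x - y‖

/-- Potential energy `E_pot(ρ) = -(1/2)∫∫ ρ(x)ρ(y)/|x-y| dx dy`. -/
def Epot (ρ : R3 → ℝ) : ℝ := -(1/2) * Dpair ρ

/-- Casimir functional `C(f) = ∫∫ Φ(f) dv dx`. -/
def Casimir (Φ : ℝ → ℝ) (f : R3 × R3 → ℝ) : ℝ := ∫ p, Φ (f p)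

/-- Energy-Casimir functional `H_C = E_kin + E_pot + C`. -/
def HC (Φ : ℝ → ℝ) (f : R3 × R3 → ℝ) : ℝ :=
  Ekin f + Epot (spatialDensity f) + Casimir Φ f

/-- Membership in the constraint set `F_M`. -/
structure MemFM (Φ : ℝ → ℝ) (M : ℝ) (f : R3 × R3 → ℝ) : Prop where
  nonneg : ∀ p, 0 ≤ f p
  integrable : Integrable f
  mass : (∫ p, f p) = M
  kin_int : Integrable (fun p : R3 × R3 => ‖p.2‖ ^ 2 * f p)
  cas_int : Integrable (fun p => Φ (f p))

/-- The constraint set `F_M`. -/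
def FMset (Φ : ℝ → ℝ) (M : ℝ) : Set ((R3 × R3) → ℝ) := {f | MemFM Φ M f}

/-- Hypotheses (Φ1)-(Φ3) on the Casimir function `Φ`, with derivative `Φ'`
and growth exponents `k`, `k'`. -/
structure IsPhi (Φ Φ' : ℝ → ℝ) (k k' : ℝ) : Prop where
  zero : Φ 0 = 0
  deriv_zero : Φ' 0 = 0
  hasDeriv : ∀ s ∈ Ici (0:ℝ), HasDerivAt Φ (Φ' s) s
  derivCont : ContinuousOn Φ' (Ici 0)
  nonneg : ∀ s ∈ Ici (0:ℝ), 0 ≤ Φ s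
  sconvex : StrictConvexOn ℝ (Ici 0) Φ
  k_pos : 0 < k
  k_lt : k < 3/2
  k'_pos : 0 < k'
  k'_lt : k' < 3/2
  growth_large : ∃ C > 0, ∃ F₁ > 0, ∀ s, F₁ ≤ s → C * s ^ (1 + 1/k) ≤ Φ s
  growth_small : ∃ C > 0, ∃ F₂ > 0, ∀ s, 0 ≤ s → s ≤ F₂ → Φ s ≤ C * s ^ (1 + 1/k')

/-- Potential `U_ρ(x) = -∫ ρ(y)/|x-y| dy` induced by a spatial density. -/
def U0rho (ρ : R3 → ℝ) (x : R3) : ℝ := -∫ y, ρ y / ‖x - y‖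

/-- Particle energy `E(x,v) = (1/2)|v|² + U₀(x)` for the state `f₀`. -/
def Epart (f₀ : R3 × R3 → ℝ) (p : R3 × R3) : ℝ :=
  (1/2) * ‖p.2‖ ^ 2 + U0rho (spatialDensity f₀) p.1

/-- Reduced density function `Ψ(s)`, obtained from `Φ` by minimizing the sum of kinetic
energy density and Casimir density over all velocity profiles of total mass `s`. -/
def PsiOf (Φ : ℝ → ℝ) (s : ℝ) : ℝ :=
  sInf { r : ℝ | ∃ g : R3 → ℝ, (∀ v, 0 ≤ g v) ∧ Integrable g ∧ (∫ v, g v) = s ∧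
    Integrable (fun v => (1/2) * ‖v‖ ^ 2 * g v + Φ (g v)) ∧
    r = ∫ v, ((1/2) * ‖v‖ ^ 2 * g v + Φ (g v)) }

/-- Reduced functional `H_r(ρ) = ∫ Ψ(ρ) dx + E_pot(ρ)`. -/
def Hr (Ψ : ℝ → ℝ) (ρ : R3 → ℝ) : ℝ := (∫ x, Ψ (ρ x)) + Epot ρ

/-- Membership in the reduced constraint set `R_M`. -/
structure MemRM (Ψ : ℝ → ℝ) (M : ℝ) (ρ : R3 → ℝ) : Prop where
  nonneg : ∀ x, 0 ≤ ρ x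
  integrable : Integrable ρ
  mass : (∫ x, ρ x) = M
  psi_int : Integrable (fun x => Ψ (ρ x))

/-- The reduced constraint set `R_M`. -/
def RMset (Ψ : ℝ → ℝ) (M : ℝ) : Set (R3 → ℝ) := {ρ | MemRM Ψ M ρ}

/-- Hypotheses (Ψ1)-(Ψ3) on `Ψ`, with derivative `Ψ'` and growth exponents `n`, `n'`. -/
structure IsPsi (Ψ Ψ' : ℝ → ℝ) (n n' : ℝ) : Prop where
  zero : Ψ 0 = 0
  deriv_zero : Ψ' 0 = 0
  hasDeriv : ∀ s ∈ Ici (0:ℝ), HasDerivAt Ψ (Ψ' s) s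
  derivCont : ContinuousOn Ψ' (Ici 0)
  nonneg : ∀ s ∈ Ici (0:ℝ), 0 ≤ Ψ s
  sconvex : StrictConvexOn ℝ (Ici 0) Ψ
  n_pos : 0 < n
  n_lt : n < 3
  n'_pos : 0 < n'
  n'_lt : n' < 3
  growth_large : ∃ C > 0, ∃ s₁ > 0, ∀ s, s₁ ≤ s → C * s ^ (1 + 1/n) ≤ Ψ s
  growth_small : ∃ C > 0, ∃ s₂ > 0, ∀ s, 0 ≤ s → s ≤ s₂ → Ψ s ≤ C * s ^ (1 + 1/n')

/-- Relative "distance" `d(f,f₀) = ∫∫ [Φ(f) - Φ(f₀) + E (f - f₀)] dv dx`. -/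
def dVP (Φ : ℝ → ℝ) (f₀ f : R3 × R3 → ℝ) : ℝ :=
  ∫ p, (Φ (f p) - Φ (f₀ p) + Epart f₀ p * (f p - f₀ p))

/-- Truncated Newton kernel. -/
def kerN (R : ℝ) (z : R3) : ℝ := (Iio R).indicator (fun r : ℝ => r⁻¹) ‖z‖

lemma kerN_integrable_one : Integrable (kerN 1) := by
  unfold kerN
  rw [integrable_fun_norm_addHaar (μ := (volume : Measure R3))
    (f := (Iio (1:ℝ)).indicator (fun r : ℝ => r⁻¹))]
  have h : IntegrableOn (fun y : ℝ => (Iio (1:ℝ)).indicator (fun r : ℝ => r) y) (Ioi 0) := by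
    rw [IntegrableOn, integrable_indicator_iff measurableSet_Iio, IntegrableOn,
      Measure.restrict_restrict measurableSet_Iio]
    have : IntegrableOn (fun r : ℝ => r) (Icc 0 1) := continuous_id.integrableOn_Icc
    refine this.mono_set ?_
    rintro x ⟨h1, h2⟩
    exact ⟨le_of_lt h2, le_of_lt h1⟩
  refine h.congr_fun ?_ measurableSet_Ioi
  intro y hy
  have hy : 0 < y := hy
  by_cases h1 : y < 1
  · simp [h1]
    field_simp
  · simp [h1]

lemma kerN_scale (R : ℝ) (hR : 0 < R) (z : R3) :
    kerN R z = R⁻¹ * kerN 1 (R⁻¹ • z) := by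
  unfold kerN
  have hn : ‖R⁻¹ • z‖ = R⁻¹ * ‖z‖ := by
    rw [norm_smul, Real.norm_of_nonneg (by positivity)]
  rw [hn]
  by_cases h : ‖z‖ < R
  · have h' : R⁻¹ * ‖z‖ < 1 := by
      rw [inv_mul_lt_iff₀ hR]; simpa using h
    simp [indicator, h, h']
    field_simp
  · have h' : ¬ R⁻¹ * ‖z‖ < 1 := by
      rw [inv_mul_lt_iff₀ hR]; simpa using h
    simp [indicator, h, h']

lemma kerN_integrable (R : ℝ) (hR : 0 < R) : Integrable (kerN R) := by
  have h : kerN R = fun z => R⁻¹ * kerN 1 (R⁻¹ • z) := funext (kerN_scale R hR)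
  rw [h]
  apply Integrable.const_mul
  exact (integrable_comp_smul_iff volume (kerN 1) (by positivity)).2 kerN_integrable_one

lemma kerN_integral (R : ℝ) (hR : 0 < R) : ∫ z, kerN R z = R ^ 2 * ∫ z, kerN 1 z := by
  simp_rw [kerN_scale R hR]
  rw [integral_const_mul, Measure.integral_comp_smul]
  simp [abs_of_pos hR]
  field_simp

lemma kerN_nonneg (R : ℝ) (z : R3) : 0 ≤ kerN R z := by
  unfold kerN
  by_cases h : ‖z‖ < R
  · simp [indicator, h]
  · simp [indicator, h]

lemma inv_norm_le_kerN (R : ℝ) (hR : 0 < R) (z : R3) : ‖z‖⁻¹ ≤ kerN R z + R⁻¹ := by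
  unfold kerN
  by_cases h : ‖z‖ < R
  · simp [indicator, h, hR.le]
  · simp only [indicator, mem_Iio, h, if_false, zero_add]
    exact inv_anti₀ hR (not_lt.1 h)

/-- Inner estimate. -/
lemma inner_bound (ρ : R3 → ℝ) (h0 : ∀ x, 0 ≤ ρ x) (hi : Integrable ρ) (x : R3)
    (R : ℝ) (hR : 0 < R) :
    ∫⁻ y, {y | ρ y ≤ ρ x}.indicator (fun y => ENNReal.ofReal (ρ x * ρ y / ‖x - y‖)) y
      ≤ ENNReal.ofReal (ρ x * (ρ x * (R ^ 2 * ∫ z, kerN 1 z) + R⁻¹ * ∫ y, ρ y)) := by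
  have hk : Integrable (fun y => kerN R (x - y)) := (kerN_integrable R hR).comp_sub_left x
  have hint : Integrable (fun y => ρ x * (ρ x * kerN R (x - y) + R⁻¹ * ρ y)) :=
    ((hk.const_mul _).add (hi.const_mul _)).const_mul _
  have heq : ∫ y, ρ x * (ρ x * kerN R (x - y) + R⁻¹ * ρ y)
      = ρ x * (ρ x * (R ^ 2 * ∫ z, kerN 1 z) + R⁻¹ * ∫ y, ρ y) := by
    rw [integral_const_mul, integral_add (hk.const_mul _) (hi.const_mul _), integral_const_mul,
      integral_const_mul, integral_sub_left_eq_self (kerN R) volume x, kerN_integral R hR]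
  rw [← heq, ofReal_integral_eq_lintegral_ofReal hint]
  · apply lintegral_mono
    intro y
    by_cases hy : ρ y ≤ ρ x
    · simp only [indicator, mem_ofPred_eq, hy, if_true]
      apply ENNReal.ofReal_le_ofReal
      rw [mul_div_assoc]
      apply mul_le_mul_of_nonneg_left _ (h0 x)
      calc ρ y / ‖x - y‖ = ρ y * ‖x - y‖⁻¹ := div_eq_mul_inv _ _
        _ ≤ ρ y * (kerN R (x - y) + R⁻¹) :=
            mul_le_mul_of_nonneg_left (inv_norm_le_kerN R hR _) (h0 y)
        _ = ρ y * kerN R (x - y) + R⁻¹ * ρ y := by ring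
        _ ≤ _ := by
            gcongr
            exact kerN_nonneg _ _
    · simp [indicator, hy]
  · refine Eventually.of_forall fun y => ?_
    have := h0 x
    have := h0 y
    have := kerN_nonneg R (x - y)
    simp only [Pi.zero_apply]
    positivity

/-- Choice of radius. -/
lemma radius_choice {Ψ Ψ' : ℝ → ℝ} {n n' : ℝ} (hΨ : IsPsi Ψ Ψ' n n') (c M : ℝ) (hc : 0 ≤ c)
    (hM : 0 ≤ M) : ∃ B : ℝ, 0 ≤ B ∧ ∀ s, 0 ≤ s → ∃ R, 0 < R ∧
      s * (s * (R ^ 2 * c) + R⁻¹ * M) ≤ Ψ s + B * s := by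
  obtain ⟨C, hC, s₁, hs₁, hg⟩ := hΨ.growth_large
  have hexp : 0 < 1 / n - 1 / 3 := by
    have := one_div_lt_one_div_of_lt hΨ.n_pos hΨ.n_lt
    linarith
  have ht : Tendsto (fun s : ℝ => C * s ^ (1 / n - 1 / 3)) atTop atTop :=
    (tendsto_rpow_atTop hexp).const_mul_atTop hC
  obtain ⟨T, hT⟩ := eventually_atTop.1 (ht.eventually_ge_atTop (c + M))
  set T' := max T s₁ with hT'
  have hT'0 : 0 < T' := lt_max_of_lt_right hs₁
  refine ⟨T' * c + M, by positivity, fun s hs => ?_⟩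
  by_cases h : s ≤ T'
  · refine ⟨1, one_pos, ?_⟩
    have h1 := hΨ.nonneg s hs
    have : s * (s * c) ≤ s * (T' * c) := by gcongr
    nlinarith
  · push Not at h
    have hs0 : 0 < s := hT'0.trans h
    refine ⟨s ^ (-(1/3) : ℝ), by positivity, ?_⟩
    have e1 : (s ^ (-(1/3) : ℝ)) ^ 2 = s ^ (-(2/3) : ℝ) := by
      rw [← Real.rpow_natCast, ← Real.rpow_mul hs]; norm_num
    have e2 : (s ^ (-(1/3) : ℝ))⁻¹ = s ^ (1/3 : ℝ) := by
      rw [← Real.rpow_neg hs]; norm_num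
    have e3 : s * s ^ (-(2/3) : ℝ) = s ^ (1/3 : ℝ) := by
      nth_rewrite 1 [← Real.rpow_one s]
      rw [← Real.rpow_add hs0]; norm_num
    have e4 : s * s ^ (1/3 : ℝ) * s ^ (1 / n - 1 / 3) = s ^ (1 + 1 / n) := by
      nth_rewrite 1 [← Real.rpow_one s]
      rw [← Real.rpow_add hs0, ← Real.rpow_add hs0]; congr 1; ring
    rw [e1, e2]
    have h1 := hg s ((le_max_right _ _).trans h.le)
    have h2 := hT s ((le_max_left _ _).trans h.le)
    calc s * (s * (s ^ (-(2/3) : ℝ) * c) + s ^ (1/3 : ℝ) * M)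
        = s * ((s * s ^ (-(2/3) : ℝ)) * c + s ^ (1/3 : ℝ) * M) := by ring
      _ = (s * s ^ (1/3 : ℝ)) * (c + M) := by rw [e3]; ring
      _ ≤ (s * s ^ (1/3 : ℝ)) * (C * s ^ (1 / n - 1 / 3)) := by gcongr
      _ = C * (s * s ^ (1/3 : ℝ) * s ^ (1 / n - 1 / 3)) := by ring
      _ = C * s ^ (1 + 1 / n) := by rw [e4]
      _ ≤ Ψ s := h1
      _ ≤ _ := by
        have : 0 ≤ (T' * c + M) * s := by positivity
        linarith

/-- Specialization to the kernel constant. -/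
lemma radius_choice_kerN {Ψ Ψ' : ℝ → ℝ} {n n' : ℝ} (hΨ : IsPsi Ψ Ψ' n n') (M : ℝ)
    (hM : 0 ≤ M) : ∃ B : ℝ, 0 ≤ B ∧ ∀ s, 0 ≤ s → ∃ R, 0 < R ∧
      s * (s * (R ^ 2 * ∫ z, kerN 1 z) + R⁻¹ * M) ≤ Ψ s + B * s :=
  radius_choice hΨ _ M (integral_nonneg (kerN_nonneg 1)) hM

lemma Dpair_bound_meas {Ψ : ℝ → ℝ} {M B : ℝ} (hB : 0 ≤ B)
    (hpos : ∀ s ∈ Ici (0:ℝ), 0 ≤ Ψ s)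
    (hrad : ∀ s, 0 ≤ s → ∃ R, 0 < R ∧
      s * (s * (R ^ 2 * ∫ z, kerN 1 z) + R⁻¹ * M) ≤ Ψ s + B * s)
    (ρ : R3 → ℝ) (hm : Measurable ρ) (h : MemRM Ψ M ρ) :
    Dpair ρ ≤ 2 * ((∫ x, Ψ (ρ x)) + B * M) := by
  set F : R3 → R3 → ℝ≥0∞ := fun x y => ENNReal.ofReal (ρ x * ρ y / ‖x - y‖) with hF
  set G : R3 → R3 → ℝ≥0∞ := fun x y => {y | ρ y ≤ ρ x}.indicator (F x) y with hG
  have hFm : Measurable (Function.uncurry F) := by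
    apply Measurable.ennreal_ofReal
    fun_prop
  have hGm : Measurable (Function.uncurry G) := by
    have : Function.uncurry G
        = {p : R3 × R3 | ρ p.2 ≤ ρ p.1}.indicator (Function.uncurry F) := by
      ext ⟨x, y⟩
      simp [hG, indicator, Function.uncurry]
    rw [this]
    exact hFm.indicator (measurableSet_le (hm.comp measurable_snd) (hm.comp measurable_fst))
  have hsym : ∀ x y, F x y = F y x := by
    intro x y
    simp only [hF]
    rw [norm_sub_rev, mul_comm (ρ x)]
  have hFG : ∀ x y, F x y ≤ G x y + G y x := by
    intro x y
    rcases le_total (ρ y) (ρ x) with hxy | hxy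
    · simp [hG, indicator, hxy]
    · simp [hG, indicator, hxy, hsym x y]
  have hI : 0 ≤ ∫ x, (Ψ (ρ x) + B * ρ x) := integral_nonneg fun x => by
    have := hpos (ρ x) (h.nonneg x)
    have := h.nonneg x
    simp only [Pi.zero_apply]
    positivity
  have hGint : ∫⁻ x, ∫⁻ y, G x y ≤ ENNReal.ofReal (∫ x, (Ψ (ρ x) + B * ρ x)) := by
    have hint : Integrable (fun x => Ψ (ρ x) + B * ρ x) :=
      h.psi_int.add (h.integrable.const_mul B)
    rw [ofReal_integral_eq_lintegral_ofReal hint]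
    · apply lintegral_mono
      intro x
      obtain ⟨R, hR, hle⟩ := hrad (ρ x) (h.nonneg x)
      refine (inner_bound ρ h.nonneg h.integrable x R hR).trans ?_
      rw [h.mass]
      exact ENNReal.ofReal_le_ofReal hle
    · refine Eventually.of_forall fun x => ?_
      have := hpos (ρ x) (h.nonneg x)
      have := h.nonneg x
      simp only [Pi.zero_apply]
      positivity
  have hFint : ∫⁻ x, ∫⁻ y, F x y ≤ ENNReal.ofReal (2 * ∫ x, (Ψ (ρ x) + B * ρ x)) := by
    calc ∫⁻ x, ∫⁻ y, F x y ≤ ∫⁻ x, ∫⁻ y, (G x y + G y x) :=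
          lintegral_mono fun x => lintegral_mono fun y => hFG x y
      _ = ∫⁻ x, ((∫⁻ y, G x y) + ∫⁻ y, G y x) := by
          refine lintegral_congr fun x => ?_
          exact lintegral_add_left (hGm.comp measurable_prodMk_left) _
      _ = (∫⁻ x, ∫⁻ y, G x y) + ∫⁻ x, ∫⁻ y, G y x :=
          lintegral_add_left hGm.lintegral_prod_right' _
      _ = (∫⁻ x, ∫⁻ y, G x y) + ∫⁻ x, ∫⁻ y, G x y := by
          congr 1
          exact (lintegral_lintegral_swap hGm.aemeasurable).symm
      _ ≤ _ := by
          rw [two_mul, ENNReal.ofReal_add hI hI]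
          exact add_le_add hGint hGint
  have hD : ‖Dpair ρ‖ₑ ≤ ∫⁻ x, ∫⁻ y, F x y := by
    unfold Dpair
    refine (enorm_integral_le_lintegral_enorm _).trans (lintegral_mono fun x => ?_)
    refine (enorm_integral_le_lintegral_enorm _).trans (lintegral_mono fun y => ?_)
    have := h.nonneg x
    have := h.nonneg y
    simp only [hF]
    rw [Real.enorm_of_nonneg (by positivity)]
  have hD2 := hD.trans hFint
  rw [← ofReal_norm, ENNReal.ofReal_le_ofReal_iff (by positivity),
    integral_add h.psi_int (h.integrable.const_mul B), integral_const_mul, h.mass] at hD2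
  exact (le_abs_self _).trans hD2

lemma Dpair_congr {ρ σ : R3 → ℝ} (h : ρ =ᵐ[volume] σ) : Dpair ρ = Dpair σ := by
  unfold Dpair
  apply integral_congr_ae
  filter_upwards [h] with x hx
  apply integral_congr_ae
  filter_upwards [h] with y hy
  rw [hx, hy]

lemma Hr_bddBelow {Ψ Ψ' : ℝ → ℝ} {n n' : ℝ} (hΨ : IsPsi Ψ Ψ' n n') (M : ℝ) (hM : 0 ≤ M) :
    BddBelow (Hr Ψ '' RMset Ψ M) := by
  obtain ⟨B, hB, hrad⟩ := radius_choice_kerN hΨ M hM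
  refine ⟨-(B * M), ?_⟩
  rintro _ ⟨ρ, hρ, rfl⟩
  have hρ : MemRM Ψ M ρ := hρ
  have hmk := hρ.integrable.aestronglyMeasurable
  set σ : R3 → ℝ := fun x => max (hmk.mk ρ x) 0 with hσ
  have hae : ρ =ᵐ[volume] σ := by
    filter_upwards [hmk.ae_eq_mk] with x hx
    simp only [hσ]
    rw [← hx, max_eq_left (hρ.nonneg x)]
  have haeΨ : (fun x => Ψ (ρ x)) =ᵐ[volume] fun x => Ψ (σ x) := by
    filter_upwards [hae] with x hx
    rw [hx]
  have hσm : Measurable σ := hmk.stronglyMeasurable_mk.measurable.max measurable_const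
  have hmem : MemRM Ψ M σ := ⟨fun x => le_max_right _ _, hρ.integrable.congr hae,
    (integral_congr_ae hae).symm.trans hρ.mass, hρ.psi_int.congr haeΨ⟩
  have hb := Dpair_bound_meas hB hΨ.nonneg hrad σ hσm hmem
  unfold Hr Epot
  rw [Dpair_congr hae, integral_congr_ae haeΨ]
  linarith

lemma MemRM_scale {Ψ : ℝ → ℝ} {M c : ℝ} (hc : 0 < c) {ρ : R3 → ℝ} (h : MemRM Ψ M ρ) :
    MemRM Ψ ((c ^ 3)⁻¹ * M) (fun x => ρ (c • x)) := by
  refine ⟨fun x => h.nonneg _, ?_, ?_, ?_⟩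
  · exact (integrable_comp_smul_iff volume ρ hc.ne').2 h.integrable
  · rw [Measure.integral_comp_smul, h.mass]
    simp [abs_of_pos hc]
  · exact (integrable_comp_smul_iff volume (fun x => Ψ (ρ x)) hc.ne').2 h.psi_int

lemma psi_scale {Ψ : ℝ → ℝ} {c : ℝ} (hc : 0 < c) (ρ : R3 → ℝ) :
    ∫ x, Ψ (ρ (c • x)) = (c ^ 3)⁻¹ * ∫ x, Ψ (ρ x) := by
  rw [Measure.integral_comp_smul volume (fun x => Ψ (ρ x))]
  simp [abs_of_pos hc]

lemma Dpair_scale {c : ℝ} (hc : 0 < c) (ρ : R3 → ℝ) :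
    Dpair (fun x => ρ (c • x)) = (c ^ 5)⁻¹ * Dpair ρ := by
  unfold Dpair
  have h1 : ∀ x y : R3, ρ (c • x) * ρ (c • y) / ‖x - y‖
      = c * (ρ (c • x) * ρ (c • y) / ‖c • x - c • y‖) := by
    intro x y
    rw [← smul_sub, norm_smul, Real.norm_of_nonneg hc.le]
    by_cases h : ‖x - y‖ = 0
    · simp [h]
    · field_simp
  simp_rw [h1, integral_const_mul]
  have h2 : ∀ x : R3, ∫ y, ρ (c • x) * ρ (c • y) / ‖c • x - c • y‖
      = (c ^ 3)⁻¹ * ∫ y, ρ (c • x) * ρ y / ‖c • x - y‖ := by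
    intro x
    rw [Measure.integral_comp_smul volume (fun y => ρ (c • x) * ρ y / ‖c • x - y‖)]
    simp [abs_of_pos hc]
  simp_rw [h2, integral_const_mul]
  rw [Measure.integral_comp_smul volume (fun x => ∫ y, ρ x * ρ y / ‖x - y‖)]
  simp [abs_of_pos hc]
  field_simp

/-- the scaling inequality `h_{M̄} ≥ (M̄/M)^{5/3} h_M` for `0 < M̄ ≤ M`. -/
theorem reduced_infimum_scaling
    (Ψ Ψ' : ℝ → ℝ) (n n' : ℝ) (hΨ : IsPsi Ψ Ψ' n n')
    (M Mbar : ℝ) (hMbar : 0 < Mbar) (hle : Mbar ≤ M) :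
    (Mbar / M) ^ ((5:ℝ)/3) * sInf (Hr Ψ '' RMset Ψ M) ≤ sInf (Hr Ψ '' RMset Ψ Mbar) := by
  have hM : 0 < M := hMbar.trans_le hle
  set c : ℝ := (Mbar / M) ^ ((1:ℝ)/3) with hcdef
  have hq : 0 < Mbar / M := div_pos hMbar hM
  have hc : 0 < c := Real.rpow_pos_of_pos hq _
  have hc1 : c ≤ 1 := Real.rpow_le_one hq.le ((div_le_one hM).2 hle) (by norm_num)
  have hc3 : c ^ 3 = Mbar / M := by
    rw [hcdef, ← Real.rpow_natCast, ← Real.rpow_mul hq.le]; norm_num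
  have hc5 : (Mbar / M) ^ ((5:ℝ)/3) = c ^ 5 := by
    rw [hcdef, ← Real.rpow_natCast, ← Real.rpow_mul hq.le]; norm_num
  rw [hc5]
  rcases (Hr Ψ '' RMset Ψ Mbar).eq_empty_or_nonempty with he | hne
  · have he2 : Hr Ψ '' RMset Ψ M = ∅ := by
      rw [image_eq_empty] at he ⊢
      rw [eq_empty_iff_forall_notMem] at he ⊢
      intro ρ hρ
      have h := MemRM_scale (inv_pos.2 hc) (show MemRM Ψ M ρ from hρ)
      have e : ((c⁻¹) ^ 3)⁻¹ * M = Mbar := by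
        rw [inv_pow, inv_inv, hc3]; field_simp
      rw [e] at h
      exact he _ h
    rw [he, he2]
    simp
  · apply le_csInf hne
    rintro _ ⟨ρ, hρ, rfl⟩
    have h := MemRM_scale hc (show MemRM Ψ Mbar ρ from hρ)
    have e : (c ^ 3)⁻¹ * Mbar = M := by
      rw [hc3]; field_simp
    rw [e] at h
    have hle2 := csInf_le (Hr_bddBelow hΨ M hM.le) (mem_image_of_mem (Hr Ψ) h)
    have hval : c ^ 5 * Hr Ψ (fun x => ρ (c • x)) = c ^ 2 * (∫ x, Ψ (ρ x)) + Epot ρ := by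
      unfold Hr Epot
      rw [psi_scale hc, Dpair_scale hc]
      field_simp
    have hA : 0 ≤ ∫ x, Ψ (ρ x) :=
      integral_nonneg fun x => hΨ.nonneg _ (MemRM.nonneg hρ x)
    calc c ^ 5 * sInf (Hr Ψ '' RMset Ψ M) ≤ c ^ 5 * Hr Ψ (fun x => ρ (c • x)) := by gcongr
      _ = c ^ 2 * (∫ x, Ψ (ρ x)) + Epot ρ := hval
      _ ≤ 1 * (∫ x, Ψ (ρ x)) + Epot ρ := by
          gcongr
          exact pow_le_one₀ hc.le hc1
      _ = Hr Ψ ρ := by rw [one_mul]; rfl
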